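/- For every integer p ≥ 1, the repeated contraction A^p of the Chebyshev interpolating core satisfies [A^p]^{αβ}(σ_{1:p}) = P_N^α(x_{≤p} + 2^{−p} c_N^β) for all α, β ∈ {0,…,N} and σ_{1:p} ∈ {0,1}^p, where x_{≤p} = Σ_{k=1}^{p} 2^{−k}σ_k. Moreover, the contraction [A^p A_R]^α(σ_{1:p+1}) := Σ_{β=0}^{N} [A^p]^{αβ}(σ_{1:p}) A_R^{β,1}(σ_{p+1}) satisfies [A^p A_R]^α(σ_{1:p+1}) = P_N^α(Σ_{k=1}^{p+1} 2^{−k}σ_k). -/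

import Mathlib

noncomputable section

/-- The Chebyshev–Lobatto node `c_N^α = (cos(πα/N)+1)/2`, shifted and scaled to `[0,1]`. -/
def chebNode (N α : ℕ) : ℝ := (Real.cos (Real.pi * α / N) + 1) / 2

/-- The Lagrange cardinal polynomial `P_N^α` for the Chebyshev–Lobatto grid. -/
def chebP (N α : ℕ) (x : ℝ) : ℝ :=
  ∏ β ∈ (Finset.range (N + 1)).erase α,
    (x - chebNode N β) / (chebNode N α - chebNode N β)

/-- The real value of a bit. -/
def bitVal (b : Bool) : ℝ := if b then 1 else 0

/-- The repeated contraction `A^p` of the Chebyshev interpolating core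
`A^{αβ}(σ) = P_N^α((σ + c_N^β)/2)`, with the convention `A^0 = Id`. -/
def Apow (N : ℕ) : (p : ℕ) → (Fin p → Bool) → ℕ → ℕ → ℝ
  | 0, _, α, β => if α = β then 1 else 0
  | p + 1, σ, α, β => ∑ γ ∈ Finset.range (N + 1),
      Apow N p (fun i => σ i.castSucc) α γ *
        chebP N γ ((bitVal (σ (Fin.last p)) + chebNode N β) / 2)

theorem chebNode_injOn {N : ℕ} (hN : 1 ≤ N) :
    Set.InjOn (chebNode N) (Finset.range (N + 1) : Set ℕ) := by
  have hN0 : (0 : ℝ) < N := by exact_mod_cast hN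
  have hmem : ∀ k ∈ (Finset.range (N + 1) : Set ℕ),
      Real.pi * k / N ∈ Set.Icc 0 Real.pi := by
    intro k hk
    have hk' : (k : ℝ) ≤ N := by
      exact_mod_cast Nat.lt_succ_iff.mp (Finset.mem_range.mp hk)
    refine ⟨by positivity, ?_⟩
    rw [div_le_iff₀ hN0]
    exact mul_le_mul_of_nonneg_left hk' Real.pi_pos.le
  intro a ha b hb hab
  have hcos : Real.cos (Real.pi * a / N) = Real.cos (Real.pi * b / N) := by
    unfold chebNode at hab
    linarith
  have hdiv := Real.injOn_cos (hmem a ha) (hmem b hb) hcos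
  rw [div_left_inj' hN0.ne'] at hdiv
  exact_mod_cast mul_left_cancel₀ Real.pi_ne_zero hdiv

theorem chebP_eq_eval_basis (N α : ℕ) (x : ℝ) :
    chebP N α x = (Lagrange.basis (Finset.range (N + 1)) (chebNode N) α).eval x := by
  simp only [chebP, Lagrange.basis, Lagrange.basisDivisor, Polynomial.eval_prod,
    Polynomial.eval_mul, Polynomial.eval_C, Polynomial.eval_sub, Polynomial.eval_X]
  exact Finset.prod_congr rfl fun β _ => div_eq_inv_mul _ _

theorem chebP_chebNode {N : ℕ} (hN : 1 ≤ N) {α β : ℕ} (hα : α ∈ Finset.range (N + 1))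
    (hβ : β ∈ Finset.range (N + 1)) :
    chebP N α (chebNode N β) = if α = β then 1 else 0 := by
  rw [chebP_eq_eval_basis]
  split_ifs with h
  · subst h
    exact Lagrange.eval_basis_self (chebNode_injOn hN) hα
  · exact Lagrange.eval_basis_of_ne h hβ

theorem sum_eval_chebNode_mul_chebP {N : ℕ} (hN : 1 ≤ N) {Q : Polynomial ℝ}
    (hQ : Q.degree < (N + 1 : ℕ)) (y : ℝ) :
    ∑ γ ∈ Finset.range (N + 1), Q.eval (chebNode N γ) * chebP N γ y = Q.eval y := by
  have h := Lagrange.eq_interpolate (chebNode_injOn hN) (f := Q) (by simpa using hQ)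
  conv_rhs => rw [h]
  simp [Lagrange.interpolate_apply, Polynomial.eval_finsetSum, chebP_eq_eval_basis]

theorem sum_chebP_affine_mul_chebP {N : ℕ} (hN : 1 ≤ N) {α : ℕ}
    (hα : α ∈ Finset.range (N + 1)) (a b y : ℝ) :
    ∑ γ ∈ Finset.range (N + 1), chebP N α (a + b * chebNode N γ) * chebP N γ y =
      chebP N α (a + b * y) := by
  set B := Lagrange.basis (Finset.range (N + 1)) (chebNode N) α
  set L : Polynomial ℝ := Polynomial.C b * Polynomial.X + Polynomial.C a
  have heval : ∀ x, (B.comp L).eval x = chebP N α (a + b * x) := fun x => by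
    simp [L, B, chebP_eq_eval_basis, add_comm]
  have hB : B.natDegree = N := by
    simpa using Lagrange.natDegree_basis (chebNode_injOn hN) hα
  have hdeg : (B.comp L).degree < (N + 1 : ℕ) := by
    refine Polynomial.degree_le_natDegree.trans_lt ?_
    have hcomp := Polynomial.natDegree_comp_le (p := B) (q := L)
    have hL : L.natDegree ≤ 1 := Polynomial.natDegree_linear_le
    rw [hB] at hcomp
    exact_mod_cast Nat.lt_succ_of_le (hcomp.trans (by nlinarith))
  simpa only [heval] using sum_eval_chebNode_mul_chebP hN hdeg y

theorem two_zpow_neg_add_one (n : ℤ) : (2 : ℝ) ^ (-(n + 1)) = (2 : ℝ) ^ (-n) / 2 := by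
  rw [neg_add, zpow_add₀ two_ne_zero, zpow_neg_one, div_eq_mul_inv]

theorem Apow_eq_chebP {N : ℕ} (hN : 1 ≤ N) {α : ℕ} (hα : α ∈ Finset.range (N + 1))
    (p : ℕ) (σ : Fin p → Bool) {β : ℕ} (hβ : β ∈ Finset.range (N + 1)) :
    Apow N p σ α β =
      chebP N α ((∑ k : Fin p, (2 : ℝ) ^ (-(k.val + 1 : ℤ)) * bitVal (σ k)) +
        (2 : ℝ) ^ (-(p : ℤ)) * chebNode N β) := by
  induction p generalizing β with
  | zero => simp [Apow, chebP_chebNode hN hα hβ]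
  | succ p ih =>
    rw [Apow, Finset.sum_congr rfl fun γ hγ => by rw [ih _ hγ],
      sum_chebP_affine_mul_chebP hN hα, Fin.sum_univ_castSucc]
    simp only [Fin.val_castSucc, Fin.val_last, Nat.cast_add, Nat.cast_one, two_zpow_neg_add_one]
    congr 1
    ring

/-- for `p ≥ 1`, `[A^p]^{αβ}(σ_{1:p}) = P_N^α(x_{≤p} + 2^{-p} c_N^β)`, and
`[A^p A_R]^α(σ_{1:p+1}) = P_N^α(Σ_{k=1}^{p+1} 2^{-k} σ_k)`, where
`A_R^{β,1}(σ) = P_N^β(σ/2)`. -/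
theorem stmt8 (N : ℕ) (hN : 1 ≤ N) :
    (∀ p : ℕ, 1 ≤ p → ∀ σ : Fin p → Bool,
      ∀ α ∈ Finset.range (N + 1), ∀ β ∈ Finset.range (N + 1),
        Apow N p σ α β =
          chebP N α ((∑ k : Fin p, (2 : ℝ) ^ (-(k.val + 1 : ℤ)) * bitVal (σ k)) +
            (2 : ℝ) ^ (-(p : ℤ)) * chebNode N β)) ∧
    (∀ p : ℕ, 1 ≤ p → ∀ σ : Fin (p + 1) → Bool, ∀ α ∈ Finset.range (N + 1),
      (∑ β ∈ Finset.range (N + 1),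
        Apow N p (fun i => σ i.castSucc) α β * chebP N β (bitVal (σ (Fin.last p)) / 2)) =
        chebP N α (∑ k : Fin (p + 1), (2 : ℝ) ^ (-(k.val + 1 : ℤ)) * bitVal (σ k))) := by
  refine ⟨fun p _ σ α hα β hβ => Apow_eq_chebP hN hα p σ hβ, fun p _ σ α hα => ?_⟩
  rw [Finset.sum_congr rfl fun β hβ => by rw [Apow_eq_chebP hN hα p _ hβ],
    sum_chebP_affine_mul_chebP hN hα, Fin.sum_univ_castSucc]
  simp only [Fin.val_castSucc, Fin.val_last, two_zpow_neg_add_one]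
  congr 1
  ring
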